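/- arXiv:1906.10563 — 3 statements merged into one kernel-verified Lean document; each statement's English description precedes it below -/
import Mathlib

section
/- Let φ_k : ℝ∪{∞} → ℝ∪{∞} be a sequence of continuous maps which is asymptotically Moebius (with respect to the boundary cross ratio bir of the hyperbolic plane). Then there exist a sequence (g_k) of real Möbius transformations of ℝ∪{∞} and a map φ_∞ : ℝ∪{∞} → ℝ∪{∞} such that lim_{k→∞} g_k(φ_k(ξ)) = φ_∞(ξ) for every ξ ∈ ℝ∪{∞}; moreover φ_∞ is Moebius, and in fact φ_∞ is itself a real Möbius transformation (the boundary extension of an isometry of the hyperbolic plane). (This is the main theorem of the paper in the case where the target CAT(−1) space X is the hyperbolic plane ℍ², whose isometry group acts transitively on triples of distinct boundary points.) -/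
open Filter Topology OnePoint

/-- The factor `|a - c|` appearing in the cross ratio; a factor involving `∞` is
omitted, i.e. replaced by `1`. -/
noncomputable def birFactor : OnePoint ℝ → OnePoint ℝ → ℝ
  | (x : ℝ), (y : ℝ) => |x - y|
  | _, _ => 1

/-- The cross ratio of four boundary points of the hyperbolic plane,
`bir(a,b,c,d) = |a−c|·|b−d| / (|a−d|·|b−c|)`, factors with `∞` omitted. -/
noncomputable def bir (a b c d : OnePoint ℝ) : ℝ :=
  birFactor a c * birFactor b d / (birFactor a d * birFactor b c)

/-- Four points are pairwise distinct. -/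
def PairwiseDistinct4 (a b c d : OnePoint ℝ) : Prop :=
  a ≠ b ∧ a ≠ c ∧ a ≠ d ∧ b ≠ c ∧ b ≠ d ∧ c ≠ d

/-- A sequence of maps of `∂ℍ² = ℝ ∪ {∞}` is asymptotically Moebius if on every
quadruple of pairwise distinct points the images are eventually pairwise distinct
and the cross ratios of the images converge to the cross ratio of the quadruple. -/
def AsympMoebius (φ : ℕ → OnePoint ℝ → OnePoint ℝ) : Prop :=
  ∀ a b c d : OnePoint ℝ, PairwiseDistinct4 a b c d →
    (∀ᶠ k in atTop, PairwiseDistinct4 (φ k a) (φ k b) (φ k c) (φ k d)) ∧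
    Tendsto (fun k => bir (φ k a) (φ k b) (φ k c) (φ k d)) atTop (𝓝 (bir a b c d))

/-- A Moebius map: injective, continuous, and preserving the cross ratio. -/
def IsMoebiusMap (φ : OnePoint ℝ → OnePoint ℝ) : Prop :=
  Function.Injective φ ∧ Continuous φ ∧
    ∀ a b c d : OnePoint ℝ, PairwiseDistinct4 a b c d →
      bir (φ a) (φ b) (φ c) (φ d) = bir a b c d

/-- The self-map of `ℝ ∪ {∞}` induced by a 2×2 real matrix `(a b; c d)`:
`x ↦ (ax+b)/(cx+d)`, with the usual conventions at `∞` and at `x = -d/c`. -/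
noncomputable def moebiusFun (A : Matrix (Fin 2) (Fin 2) ℝ) : OnePoint ℝ → OnePoint ℝ
  | (x : ℝ) =>
      if A 1 0 * x + A 1 1 = 0 then ∞
      else ((A 0 0 * x + A 0 1) / (A 1 0 * x + A 1 1) : ℝ)
  | ∞ => if A 1 0 = 0 then ∞ else ((A 0 0 / A 1 0 : ℝ) : OnePoint ℝ)

/-- A real Möbius transformation of `ℝ ∪ {∞}`: the map induced by some matrix in
`GL(2,ℝ)`; these are exactly the boundary extensions of isometries of `ℍ²`. -/
def IsRealMoebius (φ : OnePoint ℝ → OnePoint ℝ) : Prop :=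
  ∃ A : Matrix (Fin 2) (Fin 2) ℝ, IsUnit A.det ∧ φ = moebiusFun A

/-- Homogeneous coordinates of a point of `ℝ ∪ {∞}`: `(x, 1)` for real `x`, `(1, 0)` for `∞`. -/
noncomputable def homCoord : OnePoint ℝ → ℝ × ℝ
  | (x : ℝ) => (x, 1)
  | ∞ => (1, 0)

@[simp] lemma homCoord_coe (x : ℝ) : homCoord (x : OnePoint ℝ) = (x, 1) := rfl

@[simp] lemma homCoord_infty : homCoord ∞ = (1, 0) := rfl

/-- The determinant of the homogeneous coordinates of two points. -/
noncomputable def wedge (p q : OnePoint ℝ) : ℝ :=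
  (homCoord p).1 * (homCoord q).2 - (homCoord p).2 * (homCoord q).1

lemma wedge_eq_zero_iff (p q : OnePoint ℝ) : wedge p q = 0 ↔ p = q := by
  induction p using OnePoint.rec <;> induction q using OnePoint.rec <;>
    simp [wedge, sub_eq_zero]

lemma birFactor_eq_abs_wedge {p q : OnePoint ℝ} (h : p ≠ q) : birFactor p q = |wedge p q| := by
  induction p using OnePoint.rec <;> induction q using OnePoint.rec <;>
    simp_all [wedge, birFactor]

@[simp] lemma moebiusFun_coe (A : Matrix (Fin 2) (Fin 2) ℝ) (x : ℝ) :
    moebiusFun A (x : OnePoint ℝ) = if A 1 0 * x + A 1 1 = 0 then ∞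
      else ((A 0 0 * x + A 0 1) / (A 1 0 * x + A 1 1) : ℝ) := rfl

@[simp] lemma moebiusFun_infty (A : Matrix (Fin 2) (Fin 2) ℝ) :
    moebiusFun A ∞ = if A 1 0 = 0 then ∞ else ((A 0 0 / A 1 0 : ℝ) : OnePoint ℝ) := rfl

/-- `moebiusFun A` is the projective action of `A`: it multiplies homogeneous coordinates by `A`
up to a nonzero scalar. -/
lemma exists_homCoord_moebiusFun {A : Matrix (Fin 2) (Fin 2) ℝ} (hA : A.det ≠ 0)
    (p : OnePoint ℝ) :
    ∃ l : ℝ, l ≠ 0 ∧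
      l * (homCoord (moebiusFun A p)).1 = A 0 0 * (homCoord p).1 + A 0 1 * (homCoord p).2 ∧
      l * (homCoord (moebiusFun A p)).2 = A 1 0 * (homCoord p).1 + A 1 1 * (homCoord p).2 := by
  rw [Matrix.det_fin_two] at hA
  induction p using OnePoint.rec with
  | infty =>
    by_cases h : A 1 0 = 0
    · refine ⟨A 0 0, fun h0 => hA (by simp [h, h0]), ?_⟩
      simp [h]
    · refine ⟨A 1 0, h, ?_⟩
      simp [h]
      field_simp
  | coe x =>
    by_cases h : A 1 0 * x + A 1 1 = 0
    · refine ⟨A 0 0 * x + A 0 1, fun h0 => hA ?_, ?_⟩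
      · by_cases hc : A 1 0 = 0
        · have hd : A 1 1 = 0 := by simpa [hc] using h
          simp [hc, hd]
        · apply mul_left_cancel₀ hc
          linear_combination (A 1 0 * A 0 0) * h - A 1 0 ^ 2 * h0
      · simp [h]
    · refine ⟨A 1 0 * x + A 1 1, h, ?_⟩
      simp [h]
      field_simp

/-- A matrix scales all `wedge`s by its determinant, up to factors depending on one point each. -/
lemma exists_wedge_moebiusFun {A : Matrix (Fin 2) (Fin 2) ℝ} (hA : A.det ≠ 0) :
    ∃ l : OnePoint ℝ → ℝ, (∀ p, l p ≠ 0) ∧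
      ∀ p q, l p * l q * wedge (moebiusFun A p) (moebiusFun A q) = A.det * wedge p q := by
  choose l hl h1 h2 using exists_homCoord_moebiusFun hA
  refine ⟨l, hl, fun p q => ?_⟩
  calc l p * l q * wedge (moebiusFun A p) (moebiusFun A q)
      = (l p * (homCoord (moebiusFun A p)).1) * (l q * (homCoord (moebiusFun A q)).2)
        - (l p * (homCoord (moebiusFun A p)).2) * (l q * (homCoord (moebiusFun A q)).1) := by
        rw [wedge]; ring
    _ = A.det * wedge p q := by
        rw [h1, h2, h1, h2, wedge, Matrix.det_fin_two]; ring

lemma moebiusFun_injective {A : Matrix (Fin 2) (Fin 2) ℝ} (hA : A.det ≠ 0) :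
    Function.Injective (moebiusFun A) := by
  intro p q hpq
  obtain ⟨l, -, h⟩ := exists_wedge_moebiusFun hA
  have h := h p q
  rw [(wedge_eq_zero_iff _ _).2 hpq, mul_zero] at h
  exact (wedge_eq_zero_iff _ _).1 ((mul_eq_zero.1 h.symm).resolve_left hA)

lemma bir_moebiusFun {A : Matrix (Fin 2) (Fin 2) ℝ} (hA : A.det ≠ 0) {a b c d : OnePoint ℝ}
    (h : PairwiseDistinct4 a b c d) :
    bir (moebiusFun A a) (moebiusFun A b) (moebiusFun A c) (moebiusFun A d) = bir a b c d := by
  obtain ⟨-, hac, had, hbc, hbd, -⟩ := h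
  have hinj := moebiusFun_injective hA
  obtain ⟨l, hl, hw⟩ := exists_wedge_moebiusFun hA
  have hfac : ∀ {p q : OnePoint ℝ}, p ≠ q →
      birFactor (moebiusFun A p) (moebiusFun A q) = |A.det| * birFactor p q / (|l p| * |l q|) := by
    intro p q hpq
    rw [birFactor_eq_abs_wedge hpq, birFactor_eq_abs_wedge (hinj.ne hpq),
      eq_div_iff (mul_ne_zero (abs_ne_zero.2 (hl p)) (abs_ne_zero.2 (hl q))),
      ← abs_mul, ← abs_mul, ← abs_mul, ← hw p q, mul_comm]
  have hpos : ∀ {p q : OnePoint ℝ}, p ≠ q → birFactor p q ≠ 0 := fun hpq => by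
    rw [birFactor_eq_abs_wedge hpq]
    exact abs_ne_zero.2 ((wedge_eq_zero_iff _ _).not.2 hpq)
  have h1 := hpos had
  have h2 := hpos hbc
  have hd := abs_ne_zero.2 hA
  have la := abs_ne_zero.2 (hl a)
  have lb := abs_ne_zero.2 (hl b)
  have lc := abs_ne_zero.2 (hl c)
  have ld := abs_ne_zero.2 (hl d)
  rw [bir, bir, hfac hac, hfac hbd, hfac had, hfac hbc]
  field_simp

/-- Real Möbius transformations act transitively on triples of distinct points. -/
lemma exists_moebiusFun_triple {p q r : OnePoint ℝ} (hpq : p ≠ q) (hpr : p ≠ r) (hqr : q ≠ r) :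
    ∃ A : Matrix (Fin 2) (Fin 2) ℝ, A.det ≠ 0 ∧ moebiusFun A p = ∞ ∧
      moebiusFun A q = (0 : ℝ) ∧ moebiusFun A r = (1 : ℝ) := by
  have hpq' := (wedge_eq_zero_iff _ _).not.2 hpq
  have hrp := (wedge_eq_zero_iff _ _).not.2 hpr.symm
  have hrq := (wedge_eq_zero_iff _ _).not.2 hqr.symm
  let A : Matrix (Fin 2) (Fin 2) ℝ :=
    !![(homCoord q).2 * wedge r p, -(homCoord q).1 * wedge r p;
       (homCoord p).2 * wedge r q, -(homCoord p).1 * wedge r q]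
  have hA : A.det ≠ 0 := by
    have : A.det = -(wedge r p * wedge r q * wedge p q) := by
      simp only [A, Matrix.det_fin_two_of]
      rw [show wedge p q = (homCoord p).1 * (homCoord q).2 - (homCoord p).2 * (homCoord q).1
        from rfl]
      ring
    rw [this]
    exact neg_ne_zero.2 (mul_ne_zero (mul_ne_zero hrp hrq) hpq')
  have key : ∀ s t : OnePoint ℝ,
      (A 0 0 * (homCoord s).1 + A 0 1 * (homCoord s).2) * (homCoord t).2
        - (A 1 0 * (homCoord s).1 + A 1 1 * (homCoord s).2) * (homCoord t).1 = 0 →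
      moebiusFun A s = t := by
    intro s t hst
    obtain ⟨l, hl, h1, h2⟩ := exists_homCoord_moebiusFun hA s
    refine (wedge_eq_zero_iff _ _).1 (mul_left_cancel₀ hl ?_)
    rw [← h1, ← h2] at hst
    rw [wedge]
    linear_combination hst
  refine ⟨A, hA, key _ _ ?_, key _ _ ?_, key _ _ ?_⟩ <;> simp [A, wedge] <;> ring

lemma moebiusFun_one : moebiusFun 1 = id := by
  funext p
  induction p using OnePoint.rec <;> simp

lemma isRealMoebius_id : IsRealMoebius id := ⟨1, by simp, moebiusFun_one.symm⟩

lemma isMoebiusMap_id : IsMoebiusMap id :=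
  ⟨Function.injective_id, continuous_id, fun _ _ _ _ _ => rfl⟩

/-- The two cross ratios of a point with `∞, 0, 1` determine the point, continuously. -/
lemma eq_coe_of_ne_infty {y : OnePoint ℝ} (hy : y ≠ ∞) :
    y = (((bir ∞ (0 : ℝ) (1 : ℝ) y ^ 2 - bir ∞ (1 : ℝ) (0 : ℝ) y ^ 2 + 1) / 2 : ℝ) :
      OnePoint ℝ) := by
  induction y using OnePoint.rec with
  | infty => exact absurd rfl hy
  | coe y =>
    simp [bir, birFactor]
    ring

/-- **Main theorem (target `X = ℍ²`).** If `φ_k : ∂ℍ² → ∂ℍ²` is a sequence of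
continuous, asymptotically Moebius maps, then there are real Möbius
transformations `g_k` and a map `φ_∞` with `g_k ∘ φ_k → φ_∞` pointwise; moreover
`φ_∞` is Moebius, and in fact a real Möbius transformation (the boundary
extension of an isometry of `ℍ²`). -/
theorem asympMoebius_convergence
    (φ : ℕ → OnePoint ℝ → OnePoint ℝ)
    (hcont : ∀ k, Continuous (φ k))
    (hmoeb : AsympMoebius φ) :
    ∃ (g : ℕ → OnePoint ℝ → OnePoint ℝ) (φlim : OnePoint ℝ → OnePoint ℝ),
      (∀ k, IsRealMoebius (g k)) ∧
      (∀ ξ : OnePoint ℝ, Tendsto (fun k => g k (φ k ξ)) atTop (𝓝 (φlim ξ))) ∧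
      IsMoebiusMap φlim ∧ IsRealMoebius φlim := by
  have hquad : ∀ x : ℝ, x ≠ 0 → x ≠ 1 → PairwiseDistinct4 ∞ (0 : ℝ) (1 : ℝ) (x : OnePoint ℝ) :=
    fun x h0 h1 => by simp [PairwiseDistinct4, h0.symm, h1.symm]
  have hquad' : ∀ x : ℝ, x ≠ 0 → x ≠ 1 → PairwiseDistinct4 ∞ (1 : ℝ) (0 : ℝ) (x : OnePoint ℝ) :=
    fun x h0 h1 => by simp [PairwiseDistinct4, h0.symm, h1.symm]
  have hnorm : ∀ k, ∃ A : Matrix (Fin 2) (Fin 2) ℝ, A.det ≠ 0 ∧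
      (φ k ∞ ≠ φ k (0 : ℝ) → φ k ∞ ≠ φ k (1 : ℝ) → φ k (0 : ℝ) ≠ φ k (1 : ℝ) →
        moebiusFun A (φ k ∞) = ∞ ∧ moebiusFun A (φ k (0 : ℝ)) = (0 : ℝ) ∧
          moebiusFun A (φ k (1 : ℝ)) = (1 : ℝ)) := by
    intro k
    by_cases h : φ k ∞ ≠ φ k (0 : ℝ) ∧ φ k ∞ ≠ φ k (1 : ℝ) ∧ φ k (0 : ℝ) ≠ φ k (1 : ℝ)
    · obtain ⟨A, hA, hA'⟩ := exists_moebiusFun_triple h.1 h.2.1 h.2.2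
      exact ⟨A, hA, fun _ _ _ => hA'⟩
    · exact ⟨1, by simp, fun h1 h2 h3 => absurd ⟨h1, h2, h3⟩ h⟩
  choose A hA hnorm using hnorm
  have hfix : ∀ᶠ k in atTop, moebiusFun (A k) (φ k ∞) = ∞ ∧
      moebiusFun (A k) (φ k (0 : ℝ)) = (0 : ℝ) ∧ moebiusFun (A k) (φ k (1 : ℝ)) = (1 : ℝ) := by
    filter_upwards [(hmoeb _ _ _ _ (hquad 2 (by norm_num) (by norm_num))).1] with k hk
    exact hnorm k hk.1 hk.2.1 hk.2.2.2.1
  refine ⟨fun k => moebiusFun (A k), id, fun k => ⟨A k, (hA k).isUnit, rfl⟩, fun ξ => ?_,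
    isMoebiusMap_id, isRealMoebius_id⟩
  induction ξ using OnePoint.rec with
  | infty => exact tendsto_const_nhds.congr' (hfix.mono fun k hk => hk.1.symm)
  | coe x =>
    by_cases h0 : x = 0
    · subst h0
      exact tendsto_const_nhds.congr' (hfix.mono fun k hk => hk.2.1.symm)
    by_cases h1 : x = 1
    · subst h1
      exact tendsto_const_nhds.congr' (hfix.mono fun k hk => hk.2.2.symm)
    obtain ⟨hd, ht⟩ := hmoeb _ _ _ _ (hquad x h0 h1)
    obtain ⟨hd', ht'⟩ := hmoeb _ _ _ _ (hquad' x h0 h1)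
    have hlim := (OnePoint.continuous_coe.tendsto _).comp
      ((((ht.pow 2).sub (ht'.pow 2)).add_const 1).div_const 2)
    rw [← eq_coe_of_ne_infty (OnePoint.coe_ne_infty x)] at hlim
    refine hlim.congr' ?_
    filter_upwards [hfix, hd, hd'] with k hk hk1 hk2
    have hne : moebiusFun (A k) (φ k x) ≠ ∞ := fun h =>
      hk1.2.2.1 (moebiusFun_injective (hA k) (hk.1.trans h.symm))
    have e1 := bir_moebiusFun (hA k) hk1
    have e2 := bir_moebiusFun (hA k) hk2
    rw [hk.1, hk.2.1, hk.2.2] at e1 e2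
    rw [eq_coe_of_ne_infty hne, e1, e2]
    rfl
end

section
/- Let ψ_k : ℝ∪{∞} → ℝ∪{∞} be a sequence of continuous maps which is asymptotically Moebius (with respect to the boundary cross ratio bir of the hyperbolic plane). Suppose there exist pairwise distinct points ξ₀, η₀, ξ₁ ∈ ℝ∪{∞} and pairwise distinct points ξ₀′, η₀′, ξ₁′ ∈ ℝ∪{∞} such that ψ_k(ξ₀) = ξ₀′, ψ_k(η₀) = η₀′ and ψ_k(ξ₁) = ξ₁′ for every k. Then for every point η₁ ∈ ℝ∪{∞} distinct from ξ₀, η₀, ξ₁, the sequence (ψ_k(η₁))_k converges in ℝ∪{∞}. (This is Lemma 3.1 of the paper in the case where the target CAT(−1) space X is the hyperbolic plane ℍ².) -/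
open Filter Topology OnePoint

/-- A real sequence converges as soon as the absolute values of two independent
nonconstant affine functions of it converge. -/
theorem exists_tendsto_of_tendsto_abs_affine {ι : Type*} {l : Filter ι} {u : ι → ℝ}
    {s₁ t₁ s₂ t₂ p q : ℝ} (ht₁ : t₁ ≠ 0) (ht₂ : t₂ ≠ 0) (hst : s₁ * t₂ - s₂ * t₁ ≠ 0)
    (hp : Tendsto (fun k => |s₁ + t₁ * u k|) l (𝓝 p))
    (hq : Tendsto (fun k => |s₂ + t₂ * u k|) l (𝓝 q)) :
    ∃ v, Tendsto u l (𝓝 v) := by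
  refine ⟨_, (((((hp.pow 2).mul_const (t₂ ^ 2)).sub ((hq.pow 2).mul_const (t₁ ^ 2))).sub_const
    (s₁ ^ 2 * t₂ ^ 2 - s₂ ^ 2 * t₁ ^ 2)).div_const
      (2 * t₁ * t₂ * (s₁ * t₂ - s₂ * t₁))).congr fun k => ?_⟩
  rw [sq_abs, sq_abs, div_eq_iff (by positivity)]
  ring

/-- The coordinate `x ↦ 1 / (x - c)` on `ℝ ∪ {∞}`, which sends `∞` to `0`. -/
noncomputable def invCoord (c : ℝ) : OnePoint ℝ → ℝ
  | (x : ℝ) => (x - c)⁻¹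
  | ∞ => 0

/-- The parametrization `u ↦ c + 1 / u` of `(ℝ ∪ {∞}) \ {c}`, which sends `0` to `∞`. -/
noncomputable def invParam (c u : ℝ) : OnePoint ℝ :=
  if u = 0 then ∞ else ((c + u⁻¹ : ℝ) : OnePoint ℝ)

theorem invParam_invCoord {c : ℝ} {x : OnePoint ℝ} (hx : x ≠ c) :
    invParam c (invCoord c x) = x := by
  induction x using OnePoint.rec with
  | infty => simp [invParam, invCoord]
  | coe x =>
    have : x - c ≠ 0 := sub_ne_zero.2 fun h => hx (by rw [h])
    simp [invParam, invCoord, this]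

theorem continuous_invParam (c : ℝ) : Continuous (invParam c) := by
  refine continuous_iff_continuousAt.2 fun u => ?_
  rcases eq_or_ne u 0 with rfl | hu
  · rw [continuousAt_iff_punctured_nhds]
    have h : Tendsto (fun u : ℝ => c + u⁻¹) (𝓝[≠] 0) (cocompact ℝ) := by
      rw [← Metric.cobounded_eq_cocompact]
      exact (tendsto_const_add_cobounded c).comp tendsto_inv₀_nhdsNE_zero
    have h' : Tendsto ((↑) : ℝ → OnePoint ℝ) (cocompact ℝ) (𝓝 ∞) := by
      rw [← coclosedCompact_eq_cocompact]
      exact OnePoint.tendsto_coe_infty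
    have h0 : invParam c 0 = ∞ := if_pos rfl
    rw [h0]
    refine (h'.comp h).congr' ?_
    filter_upwards [self_mem_nhdsWithin] with v hv
    exact (if_neg hv).symm
  · have h : ContinuousAt (fun u : ℝ => ((c + u⁻¹ : ℝ) : OnePoint ℝ)) u :=
      OnePoint.continuous_coe.continuousAt.comp
        (continuousAt_const.add (continuousAt_inv₀ hu))
    refine h.congr ?_
    filter_upwards [isOpen_ne.mem_nhds hu] with v hv
    exact (if_neg hv).symm

theorem birFactor_coe_div_birFactor_coe {c : ℝ} (a : ℝ) {x : OnePoint ℝ} (hx : x ≠ c) :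
    birFactor x a / birFactor x c = |1 + (c - a) * invCoord c x| := by
  induction x using OnePoint.rec with
  | infty => simp [birFactor, invCoord]
  | coe x =>
    have : x - c ≠ 0 := sub_ne_zero.2 fun h => hx (by rw [h])
    simp only [birFactor, invCoord]
    rw [← abs_div]
    congr 1
    field_simp
    ring

theorem birFactor_infty_div_birFactor_coe (c : ℝ) {x : OnePoint ℝ} (hx : x ≠ ∞) :
    birFactor x ∞ / birFactor x c = |0 + 1 * invCoord c x| := by
  induction x using OnePoint.rec with
  | infty => exact absurd rfl hx
  | coe x => simp [birFactor, invCoord]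

theorem birFactor_ne_zero {x y : OnePoint ℝ} (h : x ≠ y) : birFactor x y ≠ 0 := by
  induction x using OnePoint.rec with
  | infty => simp [birFactor]
  | coe x =>
    induction y using OnePoint.rec with
    | infty => simp [birFactor]
    | coe y => exact abs_ne_zero.2 (sub_ne_zero.2 fun e => h (by rw [e]))

/-- Convergence of the ratios of the distances to three distinct points, two of them finite,
implies convergence in `ℝ ∪ {∞}`. -/
theorem exists_tendsto_of_tendsto_birFactor_div {ι : Type*} {l : Filter ι} {x : ι → OnePoint ℝ}
    {a : OnePoint ℝ} {b c p q : ℝ} (hab : a ≠ b) (hac : a ≠ c) (hbc : b ≠ c)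
    (hxa : ∀ᶠ k in l, x k ≠ a) (hxc : ∀ᶠ k in l, x k ≠ c)
    (hp : Tendsto (fun k => birFactor (x k) a / birFactor (x k) c) l (𝓝 p))
    (hq : Tendsto (fun k => birFactor (x k) b / birFactor (x k) c) l (𝓝 q)) :
    ∃ y, Tendsto x l (𝓝 y) := by
  have hq' : Tendsto (fun k => |1 + (c - b) * invCoord c (x k)|) l (𝓝 q) :=
    hq.congr' (hxc.mono fun k hk => birFactor_coe_div_birFactor_coe b hk)
  have hcb : c - b ≠ 0 := sub_ne_zero.2 hbc.symm
  obtain ⟨v, hv⟩ : ∃ v, Tendsto (fun k => invCoord c (x k)) l (𝓝 v) := by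
    induction a using OnePoint.rec with
    | infty =>
      exact exists_tendsto_of_tendsto_abs_affine one_ne_zero hcb (by simp)
        (hp.congr' (hxa.mono fun k hk => birFactor_infty_div_birFactor_coe c hk)) hq'
    | coe a =>
      have hca : c - a ≠ 0 := sub_ne_zero.2 fun h => hac (by rw [h])
      have hba : 1 * (c - b) - 1 * (c - a) ≠ 0 := fun h => hab (by
        rw [show a = b by linarith])
      exact exists_tendsto_of_tendsto_abs_affine hca hcb hba
        (hp.congr' (hxc.mono fun k hk => birFactor_coe_div_birFactor_coe a hk)) hq'
  exact ⟨_, (((continuous_invParam c).tendsto v).comp hv).congr'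
    (hxc.mono fun k hk => invParam_invCoord hk)⟩

theorem AsympMoebius.exists_tendsto_birFactor_div {ψ : ℕ → OnePoint ℝ → OnePoint ℝ}
    (hψ : AsympMoebius ψ) {x a b c a' b' c' : OnePoint ℝ} (hd : PairwiseDistinct4 x b a c)
    (hba : b' ≠ a') (hbc : b' ≠ c')
    (ha : ∀ k, ψ k a = a') (hb : ∀ k, ψ k b = b') (hc : ∀ k, ψ k c = c') :
    ∃ p, Tendsto (fun k => birFactor (ψ k x) a' / birFactor (ψ k x) c') atTop (𝓝 p) := by
  have h := (hψ x b a c hd).2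
  simp only [ha, hb, hc] at h
  refine ⟨_, (h.mul_const (birFactor b' a' / birFactor b' c')).congr fun k => ?_⟩
  have h₁ := birFactor_ne_zero hba
  have h₂ := birFactor_ne_zero hbc
  rw [bir, div_mul_div_comm, mul_assoc, mul_assoc, mul_comm (birFactor b' c'),
    mul_div_mul_right _ _ (mul_ne_zero h₁ h₂)]

/-- The limit exists when the images of two of the three normalized points are finite. -/
theorem AsympMoebius.exists_tendsto_of_ne_infty {ψ : ℕ → OnePoint ℝ → OnePoint ℝ}
    (hψ : AsympMoebius ψ) {x a b c a' b' c' : OnePoint ℝ}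
    (hab : a ≠ b) (hac : a ≠ c) (hbc : b ≠ c) (hab' : a' ≠ b') (hac' : a' ≠ c') (hbc' : b' ≠ c')
    (ha : ∀ k, ψ k a = a') (hb : ∀ k, ψ k b = b') (hc : ∀ k, ψ k c = c')
    (hxa : x ≠ a) (hxb : x ≠ b) (hxc : x ≠ c) (hb' : b' ≠ ∞) (hc' : c' ≠ ∞) :
    ∃ l, Tendsto (fun k => ψ k x) atTop (𝓝 l) := by
  obtain ⟨p, hp⟩ := hψ.exists_tendsto_birFactor_div
    ⟨hxb, hxa, hxc, hab.symm, hbc, hac⟩ hab'.symm hbc' ha hb hc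
  have hd : PairwiseDistinct4 x a b c := ⟨hxa, hxb, hxc, hab, hac, hbc⟩
  obtain ⟨q, hq⟩ := hψ.exists_tendsto_birFactor_div hd hab' hac' hb ha hc
  have hne := (hψ x a b c hd).1
  obtain ⟨b', rfl⟩ := OnePoint.ne_infty_iff_exists.1 hb'
  obtain ⟨c', rfl⟩ := OnePoint.ne_infty_iff_exists.1 hc'
  exact exists_tendsto_of_tendsto_birFactor_div hab' hac' (fun h => hbc' (by rw [h]))
    (hne.mono fun k hk => ha k ▸ hk.1) (hne.mono fun k hk => hc k ▸ hk.2.2.1) hp hq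

/-- **Lemma 3.1 (target `X = ℍ²`).** If `ψ_k : ∂ℍ² → ∂ℍ²` is a sequence of
continuous asymptotically Moebius maps fixing the images of a triple of pairwise
distinct points, then for every further point `η₁` the sequence `ψ_k(η₁)`
converges in `ℝ ∪ {∞}`. -/
theorem asympMoebius_pointwise_limit_exists
    (ψ : ℕ → OnePoint ℝ → OnePoint ℝ)
    (hcont : ∀ k, Continuous (ψ k))
    (hmoeb : AsympMoebius ψ)
    (ξ₀ η₀ ξ₁ : OnePoint ℝ) (h₁ : ξ₀ ≠ η₀) (h₂ : ξ₀ ≠ ξ₁) (h₃ : η₀ ≠ ξ₁)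
    (ξ₀' η₀' ξ₁' : OnePoint ℝ) (h₁' : ξ₀' ≠ η₀') (h₂' : ξ₀' ≠ ξ₁') (h₃' : η₀' ≠ ξ₁')
    (hfix : ∀ k, ψ k ξ₀ = ξ₀' ∧ ψ k η₀ = η₀' ∧ ψ k ξ₁ = ξ₁')
    (η₁ : OnePoint ℝ) (hd₀ : η₁ ≠ ξ₀) (hd₁ : η₁ ≠ η₀) (hd₂ : η₁ ≠ ξ₁) :
    ∃ l : OnePoint ℝ, Tendsto (fun k => ψ k η₁) atTop (𝓝 l) := by
  have hξ₀ := fun k => (hfix k).1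
  have hη₀ := fun k => (hfix k).2.1
  have hξ₁ := fun k => (hfix k).2.2
  by_cases hξ : ξ₀' = ∞
  · exact hmoeb.exists_tendsto_of_ne_infty h₁ h₂ h₃ h₁' h₂' h₃' hξ₀ hη₀ hξ₁ hd₀ hd₁ hd₂
      (hξ ▸ h₁'.symm) (hξ ▸ h₂'.symm)
  by_cases hη : η₀' = ∞
  · exact hmoeb.exists_tendsto_of_ne_infty h₁.symm h₃ h₂ h₁'.symm h₃' h₂' hη₀ hξ₀ hξ₁
      hd₁ hd₀ hd₂ hξ (hη ▸ h₃'.symm)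
  · exact hmoeb.exists_tendsto_of_ne_infty h₂.symm h₃.symm h₁ h₂'.symm h₃'.symm h₁' hξ₁ hξ₀ hη₀
      hd₂ hd₀ hd₁ hξ hη
end

section
/- Every Moebius map φ : ℝ∪{∞} → ℝ∪{∞}, i.e. every injective continuous map preserving the cross ratio bir on quadruples of pairwise distinct points, is a real Möbius transformation: there is A = (a b; c d) ∈ GL(2,ℝ) with φ(x) = (ax+b)/(cx+d) for all x (with the usual conventions at ∞). Equivalently, φ is the boundary extension of an isometry of the hyperbolic plane ℍ². (This is Bourdon's rigidity theorem, which the paper relies on, in the case S = X = ℍ².) -/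
open Filter Topology OnePoint

theorem moebiusFun_coe_eq_smul (g : GL (Fin 2) ℝ) (x : OnePoint ℝ) :
    moebiusFun g x = g • x := by
  cases x with
  | infty => simp [moebiusFun, smul_infty_eq_ite]
  | coe x => simp [moebiusFun, smul_some_eq_ite]

@[simp] theorem birFactor_coe_coe (x y : ℝ) : birFactor x y = |x - y| := rfl

@[simp] theorem birFactor_infty_left (x : OnePoint ℝ) : birFactor ∞ x = 1 := rfl

@[simp] theorem birFactor_infty_right (x : OnePoint ℝ) : birFactor x ∞ = 1 := by
  cases x <;> rfl

theorem birFactor_comm (x y : OnePoint ℝ) : birFactor x y = birFactor y x := by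
  cases x <;> cases y <;> simp [abs_sub_comm]

theorem birFactor_pos {x y : OnePoint ℝ} (h : x ≠ y) : 0 < birFactor x y := by
  cases x <;> cases y <;> simp_all [sub_eq_zero]

/-- The absolute value of the scalar normalising the image under `g` of the standard
homogeneous coordinates of a point of the projective line. -/
noncomputable def conformalDenom (g : GL (Fin 2) ℝ) : OnePoint ℝ → ℝ
  | (x : ℝ) => if g 1 0 * x + g 1 1 = 0 then |g 0 0 * x + g 0 1| else |g 1 0 * x + g 1 1|
  | ∞ => if g 1 0 = 0 then |g 0 0| else |g 1 0|

theorem conformalDenom_coe (g : GL (Fin 2) ℝ) (x : ℝ) : conformalDenom g x =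
    if g 1 0 * x + g 1 1 = 0 then |g 0 0 * x + g 0 1| else |g 1 0 * x + g 1 1| := rfl

theorem conformalDenom_infty (g : GL (Fin 2) ℝ) : conformalDenom g ∞ =
    if g 1 0 = 0 then |g 0 0| else |g 1 0| := rfl

theorem conformalDenom_pos (g : GL (Fin 2) ℝ) (x : OnePoint ℝ) : 0 < conformalDenom g x := by
  have hg : g 0 0 * g 1 1 - g 0 1 * g 1 0 ≠ 0 := by
    simpa [Matrix.det_fin_two] using g.det_ne_zero
  cases x with
  | infty =>
    rw [conformalDenom_infty]
    split_ifs with h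
    · refine abs_pos.2 fun h0 => hg ?_
      rw [h, h0]; ring
    · exact abs_pos.2 h
  | coe x =>
    rw [conformalDenom_coe]
    split_ifs with h
    · refine abs_pos.2 fun h0 => hg ?_
      linear_combination g 0 0 * h - g 1 0 * h0
    · exact abs_pos.2 h

theorem birFactor_smul_coe_infty (g : GL (Fin 2) ℝ) (x : ℝ) :
    birFactor (g • (x : OnePoint ℝ)) (g • ∞) * (conformalDenom g x * conformalDenom g ∞) =
      |g.val.det| := by
  have hg : g 0 0 * g 1 1 - g 0 1 * g 1 0 ≠ 0 := by
    simpa [Matrix.det_fin_two] using g.det_ne_zero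
  rw [conformalDenom_coe, conformalDenom_infty, smul_some_eq_ite, smul_infty_eq_ite,
    Matrix.det_fin_two]
  split_ifs with h1 h2 h2
  · exact absurd (by linear_combination g 0 0 * h1 - (g 0 1 + g 0 0 * x) * h2) hg
  · rw [birFactor_infty_left, one_mul, ← abs_mul, ← abs_neg]
    congr 1
    linear_combination -g 0 0 * h1
  · rw [birFactor_infty_right, one_mul, ← abs_mul]
    congr 1
    linear_combination (g 0 0 * x + g 0 1) * h2
  · rw [birFactor_coe_coe, ← abs_mul, ← abs_mul, div_sub_div _ _ h1 h2,
      div_mul_cancel₀ _ (mul_ne_zero h1 h2), ← abs_neg]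
    congr 1
    ring

theorem birFactor_smul_coe_coe (g : GL (Fin 2) ℝ) {x y : ℝ} (hxy : x ≠ y) :
    birFactor (g • (x : OnePoint ℝ)) (g • (y : OnePoint ℝ)) *
      (conformalDenom g x * conformalDenom g y) = |g.val.det| * |x - y| := by
  have hg : g 0 0 * g 1 1 - g 0 1 * g 1 0 ≠ 0 := by
    simpa [Matrix.det_fin_two] using g.det_ne_zero
  rw [conformalDenom_coe, conformalDenom_coe, smul_some_eq_ite, smul_some_eq_ite,
    Matrix.det_fin_two, ← abs_mul]
  split_ifs with h1 h2 h2
  · refine absurd (mul_right_cancel₀ (sub_ne_zero.2 hxy) ?_) hg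
    linear_combination (g 0 0 * y + g 0 1) * -h1 + (g 0 0 * x + g 0 1) * h2
  · rw [birFactor_infty_left, one_mul, ← abs_mul]
    congr 1
    linear_combination (g 0 0 * y + g 0 1) * h1
  · rw [birFactor_infty_right, one_mul, ← abs_mul, ← abs_neg]
    congr 1
    linear_combination -(g 0 0 * x + g 0 1) * h2
  · rw [birFactor_coe_coe, ← abs_mul, ← abs_mul, div_sub_div _ _ h1 h2,
      div_mul_cancel₀ _ (mul_ne_zero h1 h2)]
    congr 1
    ring

theorem birFactor_smul {x y : OnePoint ℝ} (g : GL (Fin 2) ℝ) (hxy : x ≠ y) :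
    birFactor (g • x) (g • y) * (conformalDenom g x * conformalDenom g y) =
      |g.val.det| * birFactor x y := by
  cases x with
  | infty =>
    cases y with
    | infty => exact absurd rfl hxy
    | coe y =>
      rw [birFactor_comm, mul_comm (conformalDenom g ∞), birFactor_smul_coe_infty,
        birFactor_infty_left, mul_one]
  | coe x =>
    cases y with
    | infty => rw [birFactor_smul_coe_infty, birFactor_infty_right, mul_one]
    | coe y => exact birFactor_smul_coe_coe g fun h => hxy (h ▸ rfl)

theorem bir_smul (g : GL (Fin 2) ℝ) {a b c d : OnePoint ℝ} (h : PairwiseDistinct4 a b c d) :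
    bir (g • a) (g • b) (g • c) (g • d) = bir a b c d := by
  obtain ⟨-, hac, had, hbc, hbd, -⟩ := h
  have e {x y : OnePoint ℝ} (hxy : x ≠ y) : birFactor (g • x) (g • y) =
      |g.val.det| * birFactor x y / (conformalDenom g x * conformalDenom g y) :=
    eq_div_of_mul_eq (mul_pos (conformalDenom_pos g x) (conformalDenom_pos g y)).ne'
      (birFactor_smul g hxy)
  have hdet : |g.val.det| ≠ 0 := abs_ne_zero.2 g.det_ne_zero
  have := (conformalDenom_pos g a).ne'
  have := (conformalDenom_pos g b).ne'
  have := (conformalDenom_pos g c).ne'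
  have := (conformalDenom_pos g d).ne'
  have := (birFactor_pos had).ne'
  have := (birFactor_pos hbc).ne'
  rw [bir, bir, e hac, e hbd, e had, e hbc]
  field_simp

theorem exists_smul_eq_infty (p : OnePoint ℝ) : ∃ g : GL (Fin 2) ℝ, g • p = ∞ := by
  cases p with
  | infty => exact ⟨1, one_smul _ _⟩
  | coe p =>
    refine ⟨Matrix.GeneralLinearGroup.mkOfDetNeZero !![0, 1; 1, -p] (by simp), ?_⟩
    simp [smul_some_eq_ite, Matrix.GeneralLinearGroup.mkOfDetNeZero]

theorem exists_smul_eq_infty_zero_one {p q r : OnePoint ℝ} (hpq : p ≠ q) (hpr : p ≠ r)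
    (hqr : q ≠ r) : ∃ g : GL (Fin 2) ℝ, g • p = ∞ ∧ g • q = (0 : ℝ) ∧ g • r = (1 : ℝ) := by
  obtain ⟨g, hg⟩ := exists_smul_eq_infty p
  obtain ⟨q', hq⟩ := ne_infty_iff_exists.1 fun h : g • q = ∞ =>
    hpq (smul_left_cancel g (hg.trans h.symm))
  obtain ⟨r', hr⟩ := ne_infty_iff_exists.1 fun h : g • r = ∞ =>
    hpr (smul_left_cancel g (hg.trans h.symm))
  have hne : r' - q' ≠ 0 := fun h => hqr <| smul_left_cancel g <| by
    rw [← hq, ← hr, sub_eq_zero.1 h]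
  refine ⟨Matrix.GeneralLinearGroup.mkOfDetNeZero !![1, -q'; 0, r' - q'] (by simpa) * g, ?_⟩
  simp only [mul_smul, hg, ← hq, ← hr]
  simp [smul_infty_eq_ite, smul_some_eq_ite, Matrix.GeneralLinearGroup.mkOfDetNeZero, hne,
    ← sub_eq_add_neg]

theorem eq_of_abs_eq_of_abs_one_sub_eq {x y : ℝ} (h0 : |y| = |x|) (h1 : |1 - y| = |1 - x|) :
    y = x := by
  have h0 := sq_eq_sq_iff_abs_eq_abs _ _ |>.2 h0
  have h1 := sq_eq_sq_iff_abs_eq_abs _ _ |>.2 h1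
  linarith

theorem eq_self_of_bir_eq {ψ : OnePoint ℝ → OnePoint ℝ} (hinj : Function.Injective ψ)
    (hbir : ∀ a b c d : OnePoint ℝ, PairwiseDistinct4 a b c d →
      bir (ψ a) (ψ b) (ψ c) (ψ d) = bir a b c d)
    (hinf : ψ ∞ = ∞) (h0 : ψ (0 : ℝ) = (0 : ℝ)) (h1 : ψ (1 : ℝ) = (1 : ℝ)) (x : OnePoint ℝ) :
    ψ x = x := by
  cases x with
  | infty => exact hinf
  | coe x =>
    by_cases hx0 : x = 0
    · rw [hx0, h0]
    by_cases hx1 : x = 1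
    · rw [hx1, h1]
    obtain ⟨y, hy⟩ := ne_infty_iff_exists.1 fun h : ψ x = ∞ =>
      coe_ne_infty x (hinj (h.trans hinf.symm))
    have e0 := hbir ∞ (0 : ℝ) (1 : ℝ) x
      ⟨infty_ne_coe _, infty_ne_coe _, infty_ne_coe _, coe_injective.ne zero_ne_one,
        coe_injective.ne (Ne.symm hx0), coe_injective.ne (Ne.symm hx1)⟩
    have e1 := hbir ∞ (1 : ℝ) (0 : ℝ) x
      ⟨infty_ne_coe _, infty_ne_coe _, infty_ne_coe _, coe_injective.ne one_ne_zero,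
        coe_injective.ne (Ne.symm hx1), coe_injective.ne (Ne.symm hx0)⟩
    simp only [hinf, h0, h1, ← hy, bir, birFactor_infty_left, birFactor_coe_coe] at e0 e1
    rw [← hy, eq_of_abs_eq_of_abs_one_sub_eq (x := x) (y := y) (by simpa using e0)
      (by simpa using e1)]

/-- **Bourdon's rigidity theorem for `S = X = ℍ²`.** Every Moebius map of
`∂ℍ² = ℝ ∪ {∞}` (injective, continuous, cross-ratio preserving) is a real Möbius
transformation, i.e. induced by a matrix in `GL(2,ℝ)` — the boundary extension of
an isometry of `ℍ²`. -/
theorem moebiusMap_is_realMoebius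
    (φ : OnePoint ℝ → OnePoint ℝ) (hφ : IsMoebiusMap φ) :
    IsRealMoebius φ := by
  obtain ⟨hinj, -, hbir⟩ := hφ
  obtain ⟨g, hinf, h0, h1⟩ := exists_smul_eq_infty_zero_one
    (hinj.ne (infty_ne_coe (0 : ℝ))) (hinj.ne (infty_ne_coe (1 : ℝ)))
    (hinj.ne (coe_injective.ne (zero_ne_one (α := ℝ))))
  refine ⟨(g⁻¹ : GL (Fin 2) ℝ), Matrix.isUnits_det_units _, funext fun x => ?_⟩
  rw [moebiusFun_coe_eq_smul, eq_inv_smul_iff]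
  refine eq_self_of_bir_eq (ψ := fun x => g • φ x) ((MulAction.injective g).comp hinj) ?_
    hinf h0 h1 x
  intro a b c d h
  rw [← hbir a b c d h]
  obtain ⟨hab, hac, had, hbc, hbd, hcd⟩ := h
  exact bir_smul g ⟨hinj.ne hab, hinj.ne hac, hinj.ne had, hinj.ne hbc, hinj.ne hbd, hinj.ne hcd⟩
end
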